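/- Let p, q be distinct primes with p > 5, let z = z(p) be the entry point of p in the Fibonacci sequence, and let n ≥ 1. Then the generalized Fibonacci–Lucas quaternion G^{p,q}_n is a zero divisor in H[Z_p] (equivalently, not a unit) if and only if there exists a natural number l with 2n + 3 = (2l + 1)·z. -/

import Mathlib

open Quaternion

/-- The Lucas sequence, as integers: `l_n = 2·f_{n+1} - f_n`
(equivalently `l_0 = 2`, `l_1 = 1`, `l_{n+2} = l_{n+1} + l_n`). -/
def lucas (n : ℕ) : ℤ := 2 * (Nat.fib (n + 1) : ℤ) - (Nat.fib n : ℤ)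

/-- The generalized Fibonacci–Lucas numbers `g^{p,q}_n = p·f_{n-1} + q·l_n` (for `n ≥ 1`). -/
def genFL (p q : ℤ) (n : ℕ) : ℤ := p * (Nat.fib (n - 1) : ℤ) + q * lucas n

/-- The n-th generalized Fibonacci–Lucas quaternion over a commutative ring `R`:
`G^{p,q}_n = g^{p,q}_n + g^{p,q}_{n+1}·i + g^{p,q}_{n+2}·j + g^{p,q}_{n+3}·k` in `ℍ[R]`. -/
def genFLQuat (R : Type*) [CommRing R] (p q : ℤ) (n : ℕ) : ℍ[R] :=
  ⟨(genFL p q n : R), (genFL p q (n + 1) : R), (genFL p q (n + 2) : R), (genFL p q (n + 3) : R)⟩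

/-- A quaternion over a commutative ring is a unit iff its norm is a unit. -/
theorem Quaternion.isUnit_iff_isUnit_normSq {R : Type*} [CommRing R] (a : ℍ[R]) :
    IsUnit a ↔ IsUnit (normSq a) := by
  refine ⟨fun h => h.map normSq, fun h => ?_⟩
  have hu : IsUnit ((normSq a : R) : ℍ[R]) := h.map (algebraMap R ℍ[R])
  have hc : Commute a (star a) := by
    rw [Commute, SemiconjBy, self_mul_star, star_mul_self]
  rw [← self_mul_star] at hu
  exact (hc.isUnit_mul_iff.mp hu).1

/-- The sum of the squares of four consecutive Lucas numbers. -/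
theorem lucas_sq_add_sq_add_sq_add_sq (n : ℕ) :
    lucas n ^ 2 + lucas (n + 1) ^ 2 + lucas (n + 2) ^ 2 + lucas (n + 3) ^ 2 =
      15 * (Nat.fib (2 * n + 3) : ℤ) := by
  have h : Nat.fib (2 * n + 3) = Nat.fib (n + 2) ^ 2 + Nat.fib (n + 1) ^ 2 :=
    Nat.fib_two_mul_add_one (n + 1)
  simp only [lucas, h, Nat.fib_add_two (n := n), Nat.fib_add_two (n := n + 1),
    Nat.fib_add_two (n := n + 2), add_assoc, Nat.reduceAdd]
  push_cast
  ring

theorem genFLQuat_zmod_normSq (p : ℕ) (q : ℤ) (n : ℕ) :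
    normSq (genFLQuat (ZMod p) (p : ℤ) q n) =
      (q : ZMod p) ^ 2 * (15 * (Nat.fib (2 * n + 3) : ZMod p)) := by
  have h := congrArg (Int.cast : ℤ → ZMod p) (lucas_sq_add_sq_add_sq_add_sq n)
  push_cast at h
  rw [normSq_def', ← h]
  simp only [genFLQuat, genFL]
  push_cast
  rw [CharP.cast_eq_zero (ZMod p) p]
  ring

/-- A number divides `f_m` iff its entry point divides `m`. -/
theorem dvd_fib_iff_entryPoint_dvd {p z : ℕ}
    (hz : IsLeast {m | 0 < m ∧ p ∣ Nat.fib m} z) (m : ℕ) : p ∣ Nat.fib m ↔ z ∣ m := by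
  refine ⟨fun h => ?_, fun h => hz.1.2.trans (Nat.fib_dvd z m h)⟩
  have hg : p ∣ Nat.fib (Nat.gcd z m) := by
    rw [Nat.fib_gcd]
    exact Nat.dvd_gcd hz.1.2 h
  have hle : z ≤ Nat.gcd z m := hz.2 ⟨Nat.gcd_pos_of_pos_left m hz.1.1, hg⟩
  exact Nat.gcd_eq_left_iff_dvd.mp (le_antisymm (Nat.gcd_le_left m hz.1.1) hle)

theorem genFLQuat_zmod_p_zeroDivisor_iff (p q : ℕ) (hp : p.Prime) (hq : q.Prime)
    (hne : p ≠ q) (hp5 : 5 < p) (z : ℕ) (hz : IsLeast {m | 0 < m ∧ p ∣ Nat.fib m} z)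
    (n : ℕ) (hn : 1 ≤ n) :
    ¬ IsUnit (genFLQuat (ZMod p) (p : ℤ) (q : ℤ) n) ↔
      ∃ l : ℕ, 2 * n + 3 = (2 * l + 1) * z := by
  have : Fact p.Prime := ⟨hp⟩
  have hq0 : (q : ZMod p) ≠ 0 := by
    rw [Ne, ZMod.natCast_eq_zero_iff, Nat.prime_dvd_prime_iff_eq hp hq]
    exact hne
  have h15 : (15 : ZMod p) ≠ 0 := by
    have h : ¬ p ∣ 3 * 5 := fun h => by
      rcases hp.dvd_mul.mp h with h | h
      all_goals have := Nat.le_of_dvd (by norm_num) h; omega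
    rw [← ZMod.natCast_eq_zero_iff] at h
    simpa only [Nat.reduceMul, Nat.cast_ofNat] using h
  rw [Quaternion.isUnit_iff_isUnit_normSq, isUnit_iff_ne_zero, not_not, genFLQuat_zmod_normSq,
    Int.cast_natCast, mul_eq_zero_iff_left (pow_ne_zero 2 hq0), mul_eq_zero_iff_left h15,
    ZMod.natCast_eq_zero_iff, dvd_fib_iff_entryPoint_dvd hz]
  constructor
  · rintro ⟨c, hc⟩
    have hodd : Odd (z * c) := hc ▸ ⟨n + 1, by ring⟩
    obtain ⟨l, rfl⟩ := (Nat.odd_mul.mp hodd).2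
    exact ⟨l, by rw [hc, mul_comm]⟩
  · rintro ⟨l, hl⟩
    exact ⟨2 * l + 1, by rw [hl, mul_comm]⟩
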